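/- Let z, z', d be natural numbers and d' an integer such that d ≤ z, z − d = z' + d + 1 or z − d = z' + d − 1, and −z' ≤ d' ≤ z. Let E be the set of subsets M of Z with card(M ∩ Z^*) = card(M ∩ Z_*) + d, and F the set of subsets N of Z with card(N ∩ Z^*) = card(N ∩ Z_*) + d' (equalities of integers). Then the matrix with rows indexed by F and columns indexed by E, whose (N, M) entry is (−1)^{card(N ∩ M)} (viewed as a matrix over ℚ), has rank equal to the cardinality of F. -/

import Mathlib

open Finset Polynomial in
/-- The signed count of the `k`-subsets of a set of odd size, signed by the parity of their
intersection with a subset of nearly half size, does not vanish. -/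
theorem sum_neg_one_pow_card_inter_ne_zero {α : Type*} [DecidableEq α] {S B : Finset α} {k : ℕ}
    (hBS : B ⊆ S) (hB : #S = 2 * #B + 1 ∨ #S + 1 = 2 * #B) (hk : k ≤ #S) :
    ∑ A ∈ S.powerset, (if #A = k then (-1 : ℚ) ^ #(A ∩ B) else 0) ≠ 0 := by
  have hprod : ∏ i ∈ S, (1 + (if i ∈ B then (-1 : ℚ[X]) else 1) * X) =
      (1 - X) ^ #B * (1 + X) ^ (#S - #B) := by
    rw [← prod_sdiff hBS, mul_comm, ← card_sdiff_of_subset hBS]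
    congr 1
    · exact prod_eq_pow_card fun i hi => by simp [hi, sub_eq_add_neg]
    · exact prod_eq_pow_card fun i hi => by simp [(mem_sdiff.1 hi).2]
  have hcoeff : (∏ i ∈ S, (1 + (if i ∈ B then (-1 : ℚ[X]) else 1) * X)).coeff k =
      ∑ A ∈ S.powerset, (if #A = k then (-1 : ℚ) ^ #(A ∩ B) else 0) := by
    rw [prod_one_add, finsetSum_coeff]
    refine sum_congr rfl fun A _ => ?_
    rw [prod_mul_distrib, prod_const, prod_ite_mem, prod_const,
      show (-1 : ℚ[X]) = C (-1) by simp, ← C_pow, coeff_C_mul, coeff_X_pow]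
    simp [eq_comm]
  have hexp (j i : ℕ) : ((1 - X ^ 2 : ℚ[X]) ^ j).coeff i =
      if 2 ∣ i then (-1) ^ (i / 2) * (j.choose (i / 2) : ℚ) else 0 := by
    have h1 : (1 - X ^ 2 : ℚ[X]) ^ j = expand ℚ 2 (((1 + X) ^ j).comp (C (-1) * X)) := by
      simp [sub_eq_add_neg]
    rw [h1, coeff_expand two_pos, comp_C_mul_X_coeff, coeff_one_add_X_pow]
    simp [mul_comm]
  have hne (j : ℕ) (hj : k / 2 ≤ j) : (-1 : ℚ) ^ (k / 2) * (j.choose (k / 2) : ℚ) ≠ 0 :=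
    mul_ne_zero (by simp) (by exact_mod_cast (Nat.choose_pos hj).ne')
  rw [← hcoeff, hprod]
  obtain ⟨j, e, he, hj, hp⟩ : ∃ (j : ℕ) (e : ℚ), e ≠ 0 ∧ #S = 2 * j + 1 ∧
      ((1 - X) ^ #B * (1 + X) ^ (#S - #B) : ℚ[X]) = (1 - X ^ 2) ^ j * (1 + C e * X) := by
    rcases hB with hB | hB
    · refine ⟨#B, 1, one_ne_zero, hB, ?_⟩
      rw [show #S - #B = #B + 1 by omega, show (1 - X ^ 2 : ℚ[X]) = (1 - X) * (1 + X) by ring,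
        mul_pow, C_1]
      ring
    · obtain ⟨j, hj⟩ : ∃ j, #B = j + 1 := ⟨#B - 1, by omega⟩
      refine ⟨j, -1, by simp, by omega, ?_⟩
      rw [show #S - #B = j by omega, hj, show (1 - X ^ 2 : ℚ[X]) = (1 - X) * (1 + X) by ring,
        mul_pow, C_neg, C_1]
      ring
  rw [hp, mul_add, mul_one, coeff_add, mul_left_comm, coeff_C_mul]
  rcases k with _ | k
  · simp [hexp]
  · rw [coeff_mul_X, hexp, hexp]
    by_cases h2 : 2 ∣ k
    · have h3 : ¬ 2 ∣ k + 1 := by omega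
      have h4 : (k + 1) / 2 = k / 2 := by omega
      rw [if_pos h2, if_neg h3, zero_add, ← h4]
      exact mul_ne_zero he (hne j (by omega))
    · have h3 : 2 ∣ k + 1 := by omega
      rw [if_neg h2, if_pos h3, mul_zero, add_zero]
      exact hne j (by omega)

open Finset in
/-- A function on the `k`-subsets of `S` which is unchanged when a single element of its argument
is exchanged for another one is constant. -/
theorem eq_of_forall_exchange {α β : Type*} [DecidableEq α] {S : Finset α} {c : Finset α → β}
    (h : ∀ x ∈ S, ∀ y ∈ S, x ≠ y → ∀ C ⊆ (S.erase x).erase y, c (insert x C) = c (insert y C))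
    {A A' : Finset α} (hA : A ⊆ S) (hA' : A' ⊆ S) (hcard : #A = #A') : c A = c A' := by
  induction hn : #(A \ A') generalizing A with
  | zero =>
    rw [card_eq_zero, sdiff_eq_empty_iff_subset] at hn
    rw [eq_of_subset_of_card_le hn hcard.ge]
  | succ n ih =>
    obtain ⟨x, hx⟩ : (A \ A').Nonempty := card_pos.1 (by omega)
    obtain ⟨y, hy⟩ : (A' \ A).Nonempty := card_pos.1 (by
      rw [← card_sdiff_comm hcard]; omega)
    rw [mem_sdiff] at hx hy
    have hyC : y ∉ A.erase x := fun hm => hy.2 (mem_of_mem_erase hm)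
    have hxy : x ≠ y := fun e => hy.2 (e ▸ hx.1)
    rw [← insert_erase hx.1, h x (hA hx.1) y (hA' hy.1) hxy]
    · refine ih (insert_subset (hA' hy.1) ((erase_subset _ _).trans hA)) ?_ ?_
      · rw [card_insert_of_notMem hyC, card_erase_add_one hx.1, hcard]
      · rw [insert_sdiff_of_mem _ hy.1, erase_sdiff_comm, card_erase_of_mem (mem_sdiff.2 hx), hn]
        rfl
    · intro a ha
      have hay : a ≠ y := fun e => hyC (e ▸ ha)
      rw [mem_erase] at ha
      simp [hay, ha.1, hA ha.2]

open Finset in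
/-- A homogeneous multilinear polynomial in an odd number of variables which vanishes on one of
the two middle layers of the cube `{1, -1}^S` is zero. -/
theorem eq_zero_of_forall_sum_neg_one_pow_card_inter {α : Type*} [DecidableEq α] {S : Finset α}
    {m k : ℕ} {c : Finset α → ℚ} (hS : #S = 2 * m + 1 ∨ #S + 1 = 2 * m)
    (hc : ∀ A ⊆ S, #A ≠ k → c A = 0)
    (h : ∀ B ⊆ S, #B = m → ∑ A ∈ S.powerset, c A * (-1) ^ #(A ∩ B) = 0) :
    ∀ A ⊆ S, c A = 0 := by
  induction m using Nat.strong_induction_on generalizing S k c with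
  | _ m ih =>
  have hex : ∀ x ∈ S, ∀ y ∈ S, x ≠ y → ∀ C ⊆ (S.erase x).erase y,
      c (insert x C) = c (insert y C) := by
    intro x hx y hy hxy
    set T := (S.erase x).erase y with hT
    have hyx : y ∈ S.erase x := mem_erase.2 ⟨hxy.symm, hy⟩
    have hST : S = insert x (insert y T) := by rw [hT, insert_erase hyx, insert_erase hx]
    have hyT : y ∉ T := by simp [hT]
    have hxT : x ∉ insert y T := by simp [hT, hxy]
    have hxT' : x ∉ T := fun hm => hxT (mem_insert_of_mem hm)
    have hTcard : #S = #T + 2 := by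
      rw [hST, card_insert_of_notMem hxT, card_insert_of_notMem hyT]
    obtain ⟨l, rfl⟩ : ∃ l, m = l + 1 := ⟨m - 1, by omega⟩
    have key := ih l (by omega) (S := T) (k := k - 1)
      (c := fun C => c (insert x C) - c (insert y C)) (by omega) ?_ ?_
    · exact fun C hC => sub_eq_zero.1 (key C hC)
    · intro C hC hCk
      have hxC : x ∉ C := fun hm => hxT' (hC hm)
      have hyC : y ∉ C := fun hm => hyT (hC hm)
      have hCS : C ⊆ S := hC.trans ((erase_subset _ _).trans (erase_subset _ _))
      rw [hc _ (insert_subset hx hCS), hc _ (insert_subset hy hCS), sub_zero]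
      · rw [card_insert_of_notMem hyC]; omega
      · rw [card_insert_of_notMem hxC]; omega
    · intro B hB hBl
      have hxB : x ∉ B := fun hm => hxT' (hB hm)
      have hyB : y ∉ B := fun hm => hyT (hB hm)
      have hBS : B ⊆ S := hB.trans ((erase_subset _ _).trans (erase_subset _ _))
      have h1 := h (insert x B) (insert_subset hx hBS) (by rw [card_insert_of_notMem hxB, hBl])
      have h2 := h (insert y B) (insert_subset hy hBS) (by rw [card_insert_of_notMem hyB, hBl])
      have h3 : (2 : ℚ) * ∑ C ∈ T.powerset,
          (c (insert x C) - c (insert y C)) * (-1) ^ #(C ∩ B) =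
          ∑ A ∈ S.powerset, c A * (-1) ^ #(A ∩ insert y B) -
          ∑ A ∈ S.powerset, c A * (-1) ^ #(A ∩ insert x B) := by
        rw [← sum_sub_distrib, hST, sum_powerset_insert hxT, sum_powerset_insert hyT,
          sum_powerset_insert hyT, ← sum_add_distrib, ← sum_add_distrib, ← sum_add_distrib,
          mul_sum]
        refine sum_congr rfl fun C hC => ?_
        have hxC : x ∉ C := fun hm => hxT' (mem_powerset.1 hC hm)
        have hyC : y ∉ C := fun hm => hyT (mem_powerset.1 hC hm)
        have hxCB : x ∉ C ∩ B := fun hm => hxC (mem_inter.1 hm).1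
        have hyCB : y ∉ C ∩ B := fun hm => hyC (mem_inter.1 hm).1
        have hxyCB : x ∉ insert y (C ∩ B) := by simp [hxy, hxC]
        have e1 : insert x C ∩ insert y B = C ∩ B := by
          rw [insert_inter_of_notMem (by simp [hxy, hxB]), inter_insert_of_notMem hyC]
        have e2 : insert y C ∩ insert x B = C ∩ B := by
          rw [insert_inter_of_notMem (by simp [hxy.symm, hyB]), inter_insert_of_notMem hxC]
        have e3 : insert x (insert y C) ∩ insert y B = insert y (C ∩ B) := by
          rw [insert_inter_of_notMem (by simp [hxy, hxB]), insert_inter_distrib]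
        have e4 : insert x (insert y C) ∩ insert x B = insert x (C ∩ B) := by
          rw [← insert_inter_distrib, insert_inter_of_notMem hyB]
        rw [e1, e2, e3, e4, inter_insert_of_notMem hxC, inter_insert_of_notMem hyC,
          ← insert_inter_distrib, ← insert_inter_distrib, card_insert_of_notMem hxCB,
          card_insert_of_notMem hyCB]
        ring
      rw [h1, h2, sub_zero] at h3
      simpa using h3
  intro A hA
  by_contra hcA
  have hAk : #A = k := by
    by_contra hne
    exact hcA (hc A hA hne)
  obtain ⟨B, hBS, rfl⟩ := exists_subset_card_eq (s := S) (n := m) (by omega)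
  refine sum_neg_one_pow_card_inter_ne_zero hBS hS (hAk ▸ card_le_card hA)
    ((mul_eq_zero_iff_left hcA).1 ?_)
  rw [mul_sum]
  refine (sum_congr rfl fun A' hA' => ?_).trans (h B hBS rfl)
  split_ifs with hk
  · rw [eq_of_forall_exchange hex hA (mem_powerset.1 hA') (hAk.trans hk.symm)]
  · rw [hc A' (mem_powerset.1 hA') hk, mul_zero, zero_mul]

open Finset in
theorem neg_one_pow_card_symmDiff_inter {α : Type*} [DecidableEq α] [Fintype α]
    (A B D : Finset α) :
    (-1 : ℚ) ^ #(symmDiff A D ∩ symmDiff B D) =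
      (-1) ^ #(A ∩ B) * (-1) ^ #(A ∩ D) * (-1) ^ #(B ∩ D) * (-1) ^ #D := by
  have key (U : Finset α) : (-1 : ℚ) ^ #U = ∏ i, if i ∈ U then -1 else 1 := by simp
  simp_rw [key, ← prod_mul_distrib]
  refine prod_congr rfl fun i _ => ?_
  by_cases hA : i ∈ A <;> by_cases hB : i ∈ B <;> by_cases hD : i ∈ D <;>
    simp [mem_symmDiff, hA, hB, hD]

open Finset in
theorem card_symmDiff_add_card_inter {α : Type*} [DecidableEq α] (A D : Finset α) :
    #(symmDiff A D) + #(A ∩ D) = #(A \ D) + #D := by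
  rw [symmDiff_def, sup_eq_union, card_union_of_disjoint disjoint_sdiff_sdiff, inter_comm,
    add_assoc, card_sdiff_add_card_inter]

theorem stmt_0 {α : Type*} [DecidableEq α] [Fintype α]
    (Zstar Zsub : Finset α) (hdisj : Disjoint Zstar Zsub)
    (hunion : Zstar ∪ Zsub = Finset.univ)
    (z z' d : ℕ) (d' : ℤ)
    (hz : Zstar.card = z) (hz' : Zsub.card = z')
    (hdz : d ≤ z)
    (hpm : (z : ℤ) - d = (z' : ℤ) + d + 1 ∨ (z : ℤ) - d = (z' : ℤ) + d - 1)
    (hd'1 : -(z' : ℤ) ≤ d') (hd'2 : d' ≤ (z : ℤ)) :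
    Matrix.rank (Matrix.of fun
        (N : {N : Finset α // ((N ∩ Zstar).card : ℤ) = ((N ∩ Zsub).card : ℤ) + d'})
        (M : {M : Finset α // ((M ∩ Zstar).card : ℤ) = ((M ∩ Zsub).card : ℤ) + (d : ℤ)}) =>
        ((-1 : ℚ)) ^ ((N.1 ∩ M.1).card))
      = Nat.card {N : Finset α // ((N ∩ Zstar).card : ℤ) = ((N ∩ Zsub).card : ℤ) + d'} := by
  rw [Nat.card_eq_fintype_card]
  apply LinearIndependent.rank_matrix
  rw [Fintype.linearIndependent_iff]
  intro g hg
  have hsd (A : Finset α) : A \ Zsub = A ∩ Zstar := by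
    ext i
    have hi : i ∈ Zstar ∪ Zsub := hunion ▸ Finset.mem_univ i
    have hi' : i ∈ Zstar → i ∉ Zsub := fun h => Finset.disjoint_left.1 hdisj h
    rw [Finset.mem_union] at hi
    simp only [Finset.mem_sdiff, Finset.mem_inter]
    tauto
  have hcard (A : Finset α) :
      (symmDiff A Zsub).card + (A ∩ Zsub).card = (A ∩ Zstar).card + z' := by
    rw [card_symmDiff_add_card_inter, hsd, hz']
  have hn : (Finset.univ : Finset α).card = z + z' := by
    rw [← hunion, Finset.card_union_of_disjoint hdisj, hz, hz']
  classical
  let e : Equiv.Perm (Finset α) := (symmDiff_left_involutive Zsub).toPerm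
  let c : Finset α → ℚ := fun N =>
    if h : ((N ∩ Zstar).card : ℤ) = ((N ∩ Zsub).card : ℤ) + d' then
      g ⟨N, h⟩ * (-1) ^ (N ∩ Zsub).card else 0
  have main := eq_zero_of_forall_sum_neg_one_pow_card_inter (S := (Finset.univ : Finset α))
    (m := z' + d) (k := (d' + z').toNat) (c := fun A => c (symmDiff A Zsub)) (by omega) ?_ ?_
  · rintro ⟨N, hN⟩
    have h := main (symmDiff N Zsub) (Finset.subset_univ _)
    simpa [c, hN] using h
  · intro A _ hA
    refine dif_neg fun h => hA ?_
    have := hcard (symmDiff A Zsub)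
    rw [symmDiff_symmDiff_cancel_right] at this
    omega
  · intro B _ hB
    have hM : ((symmDiff B Zsub ∩ Zstar).card : ℤ) = ((symmDiff B Zsub ∩ Zsub).card : ℤ) + d := by
      have := hcard (symmDiff B Zsub)
      rw [symmDiff_symmDiff_cancel_right] at this
      omega
    have hgM := congrFun hg ⟨_, hM⟩
    simp only [Finset.sum_apply, Pi.smul_apply, Matrix.row, Matrix.of_apply, smul_eq_mul,
      Pi.zero_apply] at hgM
    rw [Finset.powerset_univ, ← Equiv.sum_comp e]
    have hterm : ∑ N : {N : Finset α // ((N ∩ Zstar).card : ℤ) = ((N ∩ Zsub).card : ℤ) + d'},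
        (g N * (-1) ^ (N.1 ∩ symmDiff B Zsub).card) *
          ((-1) ^ (symmDiff B Zsub ∩ Zsub).card * (-1) ^ Zsub.card) =
        ∑ N : Finset α, c (symmDiff (e N) Zsub) * (-1) ^ (e N ∩ B).card := by
      refine Fintype.sum_of_injective Subtype.val Subtype.val_injective _ _ ?_ ?_
      · intro N hN
        have hN' : ¬ ((N ∩ Zstar).card : ℤ) = ((N ∩ Zsub).card : ℤ) + d' := by
          simpa using hN
        simp [e, c, hN']
      · rintro ⟨N, hN⟩
        have hs := neg_one_pow_card_symmDiff_inter N (symmDiff B Zsub) Zsub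
        rw [symmDiff_symmDiff_cancel_right] at hs
        have hsq : ((-1 : ℚ) ^ (N ∩ Zsub).card) * (-1) ^ (N ∩ Zsub).card = 1 := by
          rw [← mul_pow]; simp
        have he : e N = symmDiff N Zsub := rfl
        simp only [he, symmDiff_symmDiff_cancel_right, c, dif_pos hN, hs]
        linear_combination (-(g ⟨N, hN⟩ * (-1) ^ (N ∩ symmDiff B Zsub).card *
          (-1) ^ (symmDiff B Zsub ∩ Zsub).card * (-1) ^ Zsub.card)) * hsq
    rw [← hterm, ← Finset.sum_mul, hgM, zero_mul]
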